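/- Let n ≥ 1. For every f ∈ L^1_loc(ℝ^n) there exists a family (f_ε)_{ε>0} ⊂ L^1_loc(ℝ^n) such that f_ε → f in L^1_loc(ℝ^n) as ε → 0 and limsup_{ε→0} K_ε(f_ε) ≤ (1/4)·|Df|(ℝ^n). -/

import Mathlib

open MeasureTheory Filter Topology ENNReal

noncomputable section

/-- The standard open cube `(0, ε)^n` in `ℝ^n`. -/
def stdCube (n : ℕ) (ε : ℝ) : Set (EuclideanSpace ℝ (Fin n)) :=
  {x | ∀ i, x i ∈ Set.Ioo (0 : ℝ) ε}

/-- `Q ⊆ ℝ^n` is an `ε`-cube: the image of `(0,ε)^n` under a rigid motion of `ℝ^n`. -/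
def IsCube (n : ℕ) (ε : ℝ) (Q : Set (EuclideanSpace ℝ (Fin n))) : Prop :=
  ∃ T : EuclideanSpace ℝ (Fin n) ≃ᵢ EuclideanSpace ℝ (Fin n), Q = T '' stdCube n ε

/-- The BMO-type energy `K_ε(f)`: the supremum, over all countable families `H` of pairwise
disjoint `ε`-cubes, of `ε^(n-1) * Σ_{Q ∈ H} ⨍_Q |f - ⨍_Q f|`, valued in `[0,∞]`. -/
def K (n : ℕ) (ε : ℝ) (f : EuclideanSpace ℝ (Fin n) → ℝ) : ℝ≥0∞ :=
  ⨆ (H : Set (Set (EuclideanSpace ℝ (Fin n)))) (_ : H.Countable)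
    (_ : ∀ Q ∈ H, IsCube n ε Q) (_ : H.Pairwise Disjoint),
    ENNReal.ofReal (ε ^ (n - 1)) *
      ∑' Q : H, ENNReal.ofReal (⨍ x in (Q : Set (EuclideanSpace ℝ (Fin n))),
        |f x - ⨍ y in (Q : Set (EuclideanSpace ℝ (Fin n))), f y|)

/-- The divergence of a vector field `φ : ℝ^n → ℝ^n`. -/
def div' {n : ℕ} (φ : EuclideanSpace ℝ (Fin n) → EuclideanSpace ℝ (Fin n))
    (x : EuclideanSpace ℝ (Fin n)) : ℝ :=
  ∑ i, fderiv ℝ φ x (EuclideanSpace.single i 1) i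

/-- The extended total variation `|Df|(ℝ^n)`, valued in `[0,∞]`. -/
def totalVariation (n : ℕ) (f : EuclideanSpace ℝ (Fin n) → ℝ) : ℝ≥0∞ :=
  ⨆ (φ : EuclideanSpace ℝ (Fin n) → EuclideanSpace ℝ (Fin n)) (_ : ContDiff ℝ 1 φ)
    (_ : HasCompactSupport φ) (_ : ∀ x, ‖φ x‖ ≤ 1),
    ENNReal.ofReal (∫ x, f x * div' φ x)

/-- An odd function that is nonnegative on the right half-line has nonnegative integral over
`[a - s, a + s]` when `a, s ≥ 0`. -/
lemma integral_nonneg_of_odd {h : ℝ → ℝ} (hc : Continuous h) (hodd : ∀ x, h (-x) = -h x)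
    (hpos : ∀ x, 0 ≤ x → 0 ≤ h x) {a s : ℝ} (ha : 0 ≤ a) (hs : 0 ≤ s) :
    0 ≤ ∫ x in (a - s)..(a + s), h x := by
  rcases le_total s a with hsa | has
  · exact intervalIntegral.integral_nonneg (by linarith) fun x hx => hpos x (by linarith [hx.1])
  · have h0 : ∫ x in (a - s)..(s - a), h x = 0 := by
      have h1 : ∫ x in (a - s)..(s - a), h (-x) = ∫ x in (a - s)..(s - a), h x := by
        rw [intervalIntegral.integral_comp_neg]; congr 1 <;> ring
      simp only [hodd, intervalIntegral.integral_neg] at h1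
      linarith
    rw [← intervalIntegral.integral_add_adjacent_intervals
      (hc.intervalIntegrable _ (s - a)) (hc.intervalIntegrable _ _), h0, zero_add]
    exact intervalIntegral.integral_nonneg (by linarith) fun x hx => hpos x (by linarith [hx.1])

lemma integral_mul_sqrt_sq_add (c : ℝ) (hc : 0 ≤ c) (p q : ℝ) :
    ∫ x in p..q, x * √(x ^ 2 + c) = (√(q ^ 2 + c) ^ 3 - √(p ^ 2 + c) ^ 3) / 3 := by
  have hd : ∀ x : ℝ, HasDerivAt (fun x : ℝ => (x ^ 2 + c) ^ (3 / 2 : ℝ) / 3)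
      (x * √(x ^ 2 + c)) x := by
    intro x
    have h1 : HasDerivAt (fun x : ℝ => x ^ 2 + c) (2 * x) x := by
      simpa using (hasDerivAt_pow 2 x).add_const c
    have h2 := (h1.rpow_const (p := (3 / 2 : ℝ)) (Or.inr (by norm_num))).div_const 3
    refine h2.congr_deriv ?_
    rw [Real.sqrt_eq_rpow]
    norm_num
    ring
  have hcube : ∀ x : ℝ, (x ^ 2 + c) ^ (3 / 2 : ℝ) = √(x ^ 2 + c) ^ 3 := by
    intro x
    rw [Real.sqrt_eq_rpow, ← Real.rpow_mul_natCast (by positivity)]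
    norm_num
  rw [intervalIntegral.integral_eq_sub_of_hasDerivAt (fun x _ => hd x)
    (by apply Continuous.intervalIntegrable; fun_prop), hcube, hcube]
  ring

lemma cube_sub_cube_le {p q S : ℝ} (hp : 0 ≤ p) (hq : 0 ≤ q) (hqp : q ≤ p) (hS : 0 ≤ S)
    (h : p ^ 2 + q ^ 2 = 2 * S ^ 2) : 2 * (p ^ 3 - q ^ 3) ≤ 3 * (p ^ 2 - q ^ 2) * S := by
  have key : 2 * (p ^ 2 + p * q + q ^ 2) ≤ 3 * (p + q) * S := by
    apply abs_le_of_sq_le_sq' _ (by positivity) |>.2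
    have hm : 0 ≤ p * q := mul_nonneg hp hq
    have hm2 : 0 ≤ p ^ 2 + q ^ 2 - 2 * (p * q) := by nlinarith [sq_nonneg (p - q)]
    have : S ^ 2 = (p ^ 2 + q ^ 2) / 2 := by linarith
    have e : (3 * (p + q) * S) ^ 2 = 9 * (p + q) ^ 2 * ((p ^ 2 + q ^ 2) / 2) := by
      rw [← this]; ring
    rw [e]
    nlinarith [mul_nonneg hm hm2, mul_nonneg hm2 hm2]
  nlinarith [mul_le_mul_of_nonneg_left key (sub_nonneg.2 hqp)]

/-- Averaging a function over a symmetric interval of half-length `a` preserves the bound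
`∫_{-1}^1 g(s u) du ≤ √(s² + c)`, with `c` replaced by `c + a²`. -/
lemma integral_average_le_sqrt {g : ℝ → ℝ} (hg : Continuous g) {c : ℝ} (hc : 0 ≤ c)
    (h : ∀ s, 0 ≤ s → ∫ u in (-1 : ℝ)..1, g (s * u) ≤ √(s ^ 2 + c)) (a : ℝ) {s : ℝ} (hs : 0 ≤ s) :
    ∫ u in (-1 : ℝ)..1, (∫ v in (-1 : ℝ)..1, g (s * u + a * v)) / 2 ≤ √(s ^ 2 + (c + a ^ 2)) := by
  wlog ha : 0 ≤ a generalizing a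
  · have := this (-a) (by linarith)
    refine le_trans (le_of_eq ?_) (this.trans (by simp))
    congr 1; ext u
    have h1 := intervalIntegral.integral_comp_neg (fun v => g (s * u + a * v)) (a := -1) (b := 1)
    simp only [neg_neg, mul_neg] at h1
    simp only [neg_mul, ← h1]
  rcases hs.eq_or_lt with rfl | hs
  · simp only [zero_mul, zero_add, intervalIntegral.integral_const]
    have := h a ha
    refine le_trans (le_of_eq ?_) (this.trans (le_of_eq ?_))
    · rw [smul_eq_mul]; ring
    · congr 1; ring
  rcases ha.eq_or_lt with rfl | ha
  · refine le_trans (le_of_eq ?_) ((h s hs.le).trans (by simp))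
    simp only [zero_mul, add_zero, intervalIntegral.integral_const, smul_eq_mul]
    congr 1; ext u; ring
  set G : ℝ → ℝ := fun x => ∫ y in (0 : ℝ)..x, g y with hG
  have hGc : Continuous G := intervalIntegral.continuous_primitive
    (fun p q => hg.intervalIntegrable p q) 0
  have hGsub : ∀ p q, G q - G p = ∫ y in p..q, g y := fun p q => by
    rw [hG]; simp only
    rw [intervalIntegral.integral_interval_sub_left] <;> exact hg.intervalIntegrable _ _
  have hbound : ∀ x, 0 ≤ x → G x - G (-x) ≤ x * √(x ^ 2 + c) := by
    intro x hx
    rw [hGsub]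
    have := intervalIntegral.mul_integral_comp_mul_left (f := g) (a := -1) (b := 1) x
    simp only [mul_neg, mul_one] at this
    rw [← this]
    exact mul_le_mul_of_nonneg_left (h x hx) hx
  have hI : ∫ u in (-1 : ℝ)..1, (∫ v in (-1 : ℝ)..1, g (s * u + a * v)) / 2
      = (∫ x in (a - s)..(a + s), (G x - G (-x))) / (2 * s * a) := by
    have e1 : ∀ u, ∫ v in (-1 : ℝ)..1, g (s * u + a * v) = (G (s * u + a) - G (s * u - a)) / a := by
      intro u
      rw [intervalIntegral.integral_comp_add_mul _ ha.ne', hGsub]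
      simp [div_eq_inv_mul, sub_eq_add_neg]
    simp only [e1]
    rw [intervalIntegral.integral_div, intervalIntegral.integral_div,
      intervalIntegral.integral_sub
        (by apply Continuous.intervalIntegrable; fun_prop)
        (by apply Continuous.intervalIntegrable; fun_prop),
      intervalIntegral.integral_sub
        (by apply Continuous.intervalIntegrable; fun_prop)
        (by apply Continuous.intervalIntegrable; fun_prop),
      intervalIntegral.integral_comp_mul_add _ hs.ne', intervalIntegral.integral_comp_mul_sub _ hs.ne',
      intervalIntegral.integral_comp_neg]
    have r1 : s * -1 + a = a - s := by ring
    have r2 : s * 1 + a = a + s := by ring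
    have r3 : s * -1 - a = -(a + s) := by ring
    have r4 : s * 1 - a = -(a - s) := by ring
    rw [r1, r2, r3, r4, smul_eq_mul, smul_eq_mul]
    field_simp
  have hle : ∫ x in (a - s)..(a + s), (G x - G (-x)) ≤
      ∫ x in (a - s)..(a + s), x * √(x ^ 2 + c) := by
    rw [← sub_nonneg, ← intervalIntegral.integral_sub
        (by apply Continuous.intervalIntegrable; fun_prop)
        (by apply Continuous.intervalIntegrable; fun_prop)]
    refine integral_nonneg_of_odd (by fun_prop) (fun x => ?_) (fun x hx => ?_) ha.le hs.le
    · simp only [neg_neg, even_two.neg_pow]; ring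
    · linarith [hbound x hx]
  rw [hI, div_le_iff₀ (by positivity)]
  refine hle.trans ?_
  rw [integral_mul_sqrt_sq_add c hc]
  set p := √((a + s) ^ 2 + c) with hp
  set q := √((a - s) ^ 2 + c) with hq
  have hp2 : p ^ 2 = (a + s) ^ 2 + c := Real.sq_sqrt (by positivity)
  have hq2 : q ^ 2 = (a - s) ^ 2 + c := Real.sq_sqrt (by positivity)
  have hS2 : √(s ^ 2 + (c + a ^ 2)) ^ 2 = s ^ 2 + (c + a ^ 2) := Real.sq_sqrt (by positivity)
  have := cube_sub_cube_le (p := p) (q := q) (S := √(s ^ 2 + (c + a ^ 2))) (by positivity)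
    (by positivity) (Real.sqrt_le_sqrt (by nlinarith [mul_pos ha hs])) (by positivity)
    (by rw [hp2, hq2, hS2]; ring)
  have e : p ^ 2 - q ^ 2 = 4 * s * a := by rw [hp2, hq2]; ring
  rw [e] at this
  linarith

/-- The mean of `|x + ∑ aᵢ (uᵢ - ε/2)|` over `u` in the cube `(0, ε)^n`. -/
noncomputable def cubeMean (ε : ℝ) {n : ℕ} (a : Fin n → ℝ) (x : ℝ) : ℝ :=
  (ε ^ n)⁻¹ * ∫ u, |x + ∑ i, a i * (u i - ε / 2)|
    ∂(Measure.pi fun _ : Fin n => volume.restrict (Set.Ioo (0 : ℝ) ε))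

lemma integrable_pi_restrict_Ioo {n : ℕ} (ε : ℝ) {h : (Fin n → ℝ) → ℝ} (hc : Continuous h) :
    Integrable h (Measure.pi fun _ : Fin n => volume.restrict (Set.Ioo (0 : ℝ) ε)) := by
  rw [← Measure.restrict_pi_pi]
  exact (hc.continuousOn.integrableOn_compact
    (isCompact_univ_pi fun _ => isCompact_Icc (a := (0 : ℝ)) (b := ε))).mono_set
    (Set.pi_mono fun _ _ => Set.Ioo_subset_Icc_self)

lemma cubeMean_succ {ε : ℝ} (hε : 0 < ε) {n : ℕ} (a : Fin (n + 1) → ℝ) (x : ℝ) :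
    cubeMean ε a x =
      (∫ v in (-1 : ℝ)..1, cubeMean ε (fun i => a i.succ) (x + a 0 * (ε / 2) * v)) / 2 := by
  have e1 := (measurePreserving_piFinSuccAbove
    (fun _ : Fin (n + 1) => volume.restrict (Set.Ioo (0 : ℝ) ε)) 0)
  have hint : Integrable (fun z : ℝ × (Fin n → ℝ) =>
      |x + (a 0 * (z.1 - ε / 2) + ∑ i : Fin n, a i.succ * (z.2 i - ε / 2))|)
      ((volume.restrict (Set.Ioo (0 : ℝ) ε)).prod
        (Measure.pi fun _ : Fin n => volume.restrict (Set.Ioo (0 : ℝ) ε))) := by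
    rw [← e1.integrable_comp_emb (MeasurableEquiv.measurableEmbedding _)]
    apply integrable_pi_restrict_Ioo
    simp only [Function.comp_def, MeasurableEquiv.piFinSuccAbove_apply, Fin.insertNthEquiv]
    simp only [Equiv.coe_fn_symm_mk]
    simp only [Fin.removeNth]
    fun_prop
  have e2 : ∫ u, |x + ∑ i, a i * (u i - ε / 2)|
      ∂(Measure.pi fun _ : Fin (n + 1) => volume.restrict (Set.Ioo (0 : ℝ) ε)) =
      ∫ t in Set.Ioo 0 ε, ∫ w, |x + (a 0 * (t - ε / 2) + ∑ i : Fin n, a i.succ * (w i - ε / 2))|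
        ∂(Measure.pi fun _ : Fin n => volume.restrict (Set.Ioo (0 : ℝ) ε)) := by
    rw [← integral_prod _ hint, ← e1.integral_comp']
    congr 1; ext u
    rw [Fin.sum_univ_succ]
    rfl
  unfold cubeMean
  rw [e2, intervalIntegral.integral_const_mul]
  have e3 := intervalIntegral.integral_comp_mul_add (a := -1) (b := 1) (c := ε / 2)
    (fun t => ∫ w, |x + (a 0 * (t - ε / 2) + ∑ i : Fin n, a i.succ * (w i - ε / 2))|
        ∂(Measure.pi fun _ : Fin n => volume.restrict (Set.Ioo (0 : ℝ) ε)))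
    (by positivity) (ε / 2)
  have r1 : ε / 2 * -1 + ε / 2 = 0 := by ring
  have r2 : ε / 2 * 1 + ε / 2 = ε := by ring
  rw [r1, r2, intervalIntegral.integral_of_le hε.le, integral_Ioc_eq_integral_Ioo] at e3
  have e4 : ∀ v : ℝ, ∀ w : Fin n → ℝ,
      x + (a 0 * (ε / 2 * v + ε / 2 - ε / 2) + ∑ i : Fin n, a i.succ * (w i - ε / 2)) =
      x + a 0 * (ε / 2) * v + ∑ i : Fin n, a i.succ * (w i - ε / 2) := by
    intro v w; ring
  simp only [e4] at e3
  rw [e3, smul_eq_mul, pow_succ]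
  generalize (∫ t in Set.Ioo 0 ε, _ : ℝ) = I
  field_simp

lemma cubeMean_bound {ε : ℝ} (hε : 0 < ε) {n : ℕ} (a : Fin n → ℝ) :
    Continuous (cubeMean ε a) ∧ ∀ s, 0 ≤ s →
      ∫ u in (-1 : ℝ)..1, cubeMean ε a (s * u) ≤ √(s ^ 2 + ∑ i, (a i * (ε / 2)) ^ 2) := by
  induction n with
  | zero =>
    have h0 : cubeMean ε a = fun x => |x| := by
      ext x
      simp [cubeMean, measureReal_def]
    rw [h0]
    refine ⟨continuous_abs, fun s hs => ?_⟩
    simp only [abs_mul, abs_of_nonneg hs, intervalIntegral.integral_const_mul]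
    have : ∫ u in (-1 : ℝ)..1, |u| = 1 := by
      rw [← intervalIntegral.integral_add_adjacent_intervals (b := 0)
        (continuous_abs.intervalIntegrable _ _) (continuous_abs.intervalIntegrable _ _),
        intervalIntegral.integral_congr (g := fun x => -x) (a := -1) (b := 0)
          (fun x hx => by
            rw [Set.uIcc_of_le (by norm_num)] at hx; exact abs_of_nonpos hx.2),
        intervalIntegral.integral_congr (g := fun x => x) (a := 0) (b := 1)
          (fun x hx => by
            rw [Set.uIcc_of_le (by norm_num)] at hx; exact abs_of_nonneg hx.1)]
      rw [intervalIntegral.integral_neg, integral_id, integral_id]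
      norm_num
    rw [this]
    simp [Real.sqrt_sq hs]
  | succ n ih =>
    obtain ⟨hcont, hb⟩ := ih (fun i => a i.succ)
    have heq : cubeMean ε a = fun x =>
        (∫ v in (-1 : ℝ)..1, cubeMean ε (fun i => a i.succ) (x + a 0 * (ε / 2) * v)) / 2 :=
      funext (cubeMean_succ hε a)
    rw [heq]
    refine ⟨?_, fun s hs => ?_⟩
    · refine (intervalIntegral.continuous_parametric_intervalIntegral_of_continuous' ?_ _ _).div_const 2
      fun_prop
    · refine (integral_average_le_sqrt hcont (by positivity) hb (a 0 * (ε / 2)) hs).trans ?_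
      rw [Fin.sum_univ_succ, add_comm (∑ i : Fin n, _)]

/-- The sharp `L¹`-`L²` comparison for linear functions on a cube. -/
lemma integral_abs_linear_cube_le {ε : ℝ} (hε : 0 < ε) {n : ℕ} (a : Fin n → ℝ) :
    (ε ^ n)⁻¹ * ∫ u, |∑ i, a i * (u i - ε / 2)|
      ∂(Measure.pi fun _ : Fin n => volume.restrict (Set.Ioo (0 : ℝ) ε)) ≤
    ε / 4 * √(∑ i, a i ^ 2) := by
  have h := (cubeMean_bound hε a).2 0 le_rfl
  simp only [zero_mul, intervalIntegral.integral_const, mul_pow, ← Finset.sum_mul, smul_eq_mul,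
    ne_eq, OfNat.ofNat_ne_zero, not_false_eq_true, zero_pow, zero_add] at h
  rw [Real.sqrt_mul' _ (by positivity), Real.sqrt_sq (by positivity)] at h
  simp only [cubeMean, zero_add] at h
  linarith

lemma IsCube.exists_linearIsometryEquiv {n : ℕ} {ε : ℝ} {Q : Set (EuclideanSpace ℝ (Fin n))}
    (hQ : IsCube n ε Q) : ∃ (L : EuclideanSpace ℝ (Fin n) ≃ₗᵢ[ℝ] EuclideanSpace ℝ (Fin n))
      (b : EuclideanSpace ℝ (Fin n)), Q = (fun u => L u + b) '' stdCube n ε := by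
  obtain ⟨T, rfl⟩ := hQ
  refine ⟨T.toRealAffineIsometryEquiv.linearIsometryEquiv, T 0, ?_⟩
  congr 1; ext1 u
  have := T.toRealAffineIsometryEquiv.map_vadd 0 u
  simpa using this

lemma isOpen_stdCube (n : ℕ) (ε : ℝ) : IsOpen (stdCube n ε) := by
  simp only [stdCube, Set.ofPred_forall]
  exact isOpen_iInter_of_finite fun i => isOpen_Ioo.preimage (by fun_prop)

lemma IsCube.isOpen {n : ℕ} {ε : ℝ} {Q : Set (EuclideanSpace ℝ (Fin n))} (hQ : IsCube n ε Q) :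
    IsOpen Q := by
  obtain ⟨T, rfl⟩ := hQ
  exact T.toHomeomorph.isOpenMap _ (isOpen_stdCube n ε)

lemma stdCube_dist_le {n : ℕ} {ε : ℝ} {x y : EuclideanSpace ℝ (Fin n)} (hε : 0 < ε)
    (hx : x ∈ stdCube n ε) (hy : y ∈ stdCube n ε) : dist x y ≤ √n * ε := by
  rw [EuclideanSpace.dist_eq]
  refine Real.sqrt_le_iff.2 ⟨by positivity, ?_⟩
  rw [mul_pow, Real.sq_sqrt (by positivity)]
  calc ∑ i, dist (x i) (y i) ^ 2 ≤ ∑ _i : Fin n, ε ^ 2 := by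
        refine Finset.sum_le_sum fun i _ => ?_
        have h1 := hx i
        have h2 := hy i
        refine pow_le_pow_left₀ dist_nonneg ?_ 2
        rw [Real.dist_eq, abs_le]
        constructor <;> linarith [h1.1, h1.2, h2.1, h2.2]
    _ = n * ε ^ 2 := by simp

lemma IsCube.dist_le {n : ℕ} {ε : ℝ} {Q : Set (EuclideanSpace ℝ (Fin n))} (hQ : IsCube n ε Q)
    (hε : 0 < ε) {x y : EuclideanSpace ℝ (Fin n)} (hx : x ∈ Q) (hy : y ∈ Q) :
    dist x y ≤ √n * ε := by
  obtain ⟨T, rfl⟩ := hQ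
  obtain ⟨u, hu, rfl⟩ := hx
  obtain ⟨w, hw, rfl⟩ := hy
  rw [T.dist_eq]
  exact stdCube_dist_le hε hu hw

lemma IsCube.isBounded {n : ℕ} {ε : ℝ} {Q : Set (EuclideanSpace ℝ (Fin n))} (hQ : IsCube n ε Q)
    (hε : 0 < ε) : Bornology.IsBounded Q :=
  Metric.isBounded_iff.2 ⟨√n * ε, fun _ hx _ hy => hQ.dist_le hε hx hy⟩

lemma IsCube.integrableOn {n : ℕ} {ε : ℝ} {Q : Set (EuclideanSpace ℝ (Fin n))} (hQ : IsCube n ε Q)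
    (hε : 0 < ε) {g : EuclideanSpace ℝ (Fin n) → ℝ} (hg : Continuous g) :
    IntegrableOn g Q :=
  (hg.continuousOn.integrableOn_compact (hQ.isBounded hε).isCompact_closure).mono_set
    subset_closure

lemma stdCube_eq_preimage (n : ℕ) (ε : ℝ) : stdCube n ε =
    (MeasurableEquiv.toLp 2 (Fin n → ℝ)).symm ⁻¹' (Set.univ.pi fun _ => Set.Ioo 0 ε) := by
  ext x
  simp [stdCube, Set.mem_pi]

lemma volume_stdCube (n : ℕ) {ε : ℝ} (hε : 0 < ε) :
    volume (stdCube n ε) = ENNReal.ofReal (ε ^ n) := by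
  rw [stdCube_eq_preimage, (EuclideanSpace.volume_preserving_symm_measurableEquiv_toLp
    (Fin n)).measure_preimage_equiv, Real.volume_pi_Ioo]
  simp [ENNReal.ofReal_pow hε.le]

lemma setIntegral_stdCube {n : ℕ} (ε : ℝ) (h : (Fin n → ℝ) → ℝ) :
    ∫ x in stdCube n ε, h x.ofLp =
      ∫ u, h u ∂(Measure.pi fun _ : Fin n => volume.restrict (Set.Ioo (0 : ℝ) ε)) := by
  rw [stdCube_eq_preimage, ← Measure.restrict_pi_pi]
  exact (EuclideanSpace.volume_preserving_symm_measurableEquiv_toLp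
    (Fin n)).setIntegral_preimage_emb (MeasurableEquiv.measurableEmbedding _) h _

lemma measurePreserving_linearIsometryEquiv_add {n : ℕ}
    (L : EuclideanSpace ℝ (Fin n) ≃ₗᵢ[ℝ] EuclideanSpace ℝ (Fin n))
    (b : EuclideanSpace ℝ (Fin n)) : MeasurePreserving (fun u => L u + b) volume volume :=
  (measurePreserving_add_right volume b).comp L.measurePreserving

lemma measurableEmbedding_linearIsometryEquiv_add {n : ℕ}
    (L : EuclideanSpace ℝ (Fin n) ≃ₗᵢ[ℝ] EuclideanSpace ℝ (Fin n))
    (b : EuclideanSpace ℝ (Fin n)) : MeasurableEmbedding (fun u => L u + b) :=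
  (measurableEmbedding_addRight b).comp L.toHomeomorph.measurableEmbedding

lemma IsCube.volume_eq {n : ℕ} {ε : ℝ} {Q : Set (EuclideanSpace ℝ (Fin n))} (hQ : IsCube n ε Q)
    (hε : 0 < ε) : volume Q = ENNReal.ofReal (ε ^ n) := by
  obtain ⟨L, b, rfl⟩ := hQ.exists_linearIsometryEquiv
  have he := measurableEmbedding_linearIsometryEquiv_add L b
  rw [← (measurePreserving_linearIsometryEquiv_add L b).measure_preimage_emb he,
    Set.preimage_image_eq _ he.injective, volume_stdCube n hε]

/-- The center of the standard cube. -/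
noncomputable def stdCenter (n : ℕ) (ε : ℝ) : EuclideanSpace ℝ (Fin n) :=
  WithLp.toLp 2 fun _ => ε / 2

lemma setIntegral_inner_stdCube {n : ℕ} {ε : ℝ} (v : EuclideanSpace ℝ (Fin n)) :
    ∫ u in stdCube n ε, inner ℝ v (u - stdCenter n ε) = 0 := by
  have hpre : (fun u => (2 : ℝ) • stdCenter n ε - u) ⁻¹' stdCube n ε = stdCube n ε := by
    ext u
    simp only [Set.mem_preimage, stdCube, Set.mem_ofPred_eq, stdCenter, PiLp.sub_apply,
      PiLp.smul_apply, smul_eq_mul, Set.mem_Ioo]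
    refine forall_congr' fun i => ?_
    constructor <;> rintro ⟨h1, h2⟩ <;> constructor <;> linarith
  have h := (Measure.measurePreserving_sub_left (volume : Measure (EuclideanSpace ℝ (Fin n)))
    ((2 : ℝ) • stdCenter n ε)).setIntegral_preimage_emb
    ((Homeomorph.subLeft ((2 : ℝ) • stdCenter n ε)).measurableEmbedding)
    (fun u => inner ℝ v (u - stdCenter n ε)) (stdCube n ε)
  rw [hpre] at h
  have hneg : ∀ u : EuclideanSpace ℝ (Fin n),
      inner ℝ v ((2 : ℝ) • stdCenter n ε - u - stdCenter n ε) =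
        -inner ℝ v (u - stdCenter n ε) := by
    intro u
    rw [← inner_neg_right]; congr 1; rw [two_smul]; abel
  simp only [hneg, integral_neg] at h
  linarith

/-- On every cube, linear functions have mean oscillation at most `ε / 4` times their slope. -/
lemma IsCube.exists_center {n : ℕ} {ε : ℝ} {Q : Set (EuclideanSpace ℝ (Fin n))}
    (hQ : IsCube n ε Q) (hε : 0 < ε) : ∃ c : EuclideanSpace ℝ (Fin n), ∀ v,
      ⨍ x in Q, inner ℝ v (x - c) = 0 ∧ ⨍ x in Q, |inner ℝ v (x - c)| ≤ ε / 4 * ‖v‖ := by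
  have hvol := hQ.volume_eq hε
  obtain ⟨L, b, rfl⟩ := hQ.exists_linearIsometryEquiv
  refine ⟨L (stdCenter n ε) + b, fun v => ?_⟩
  have hinner : ∀ u, inner ℝ v (L u + b - (L (stdCenter n ε) + b)) =
      inner ℝ (L.symm v) (u - stdCenter n ε) := by
    intro u
    rw [add_sub_add_right_eq_sub, ← map_sub, ← L.inner_map_map (L.symm v), L.apply_symm_apply]
  have hP := measurePreserving_linearIsometryEquiv_add L b
  have he := measurableEmbedding_linearIsometryEquiv_add L b
  simp only [setAverage_eq, measureReal_def, hvol, ENNReal.toReal_ofReal (pow_nonneg hε.le n)]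
  constructor
  · rw [hP.setIntegral_image_emb he]
    simp only [hinner, setIntegral_inner_stdCube, smul_zero]
  · rw [hP.setIntegral_image_emb he]
    simp only [hinner]
    have h := integral_abs_linear_cube_le hε (L.symm v).ofLp
    rw [← setIntegral_stdCube ε (fun u => |∑ i, L.symm v i * (u i - ε / 2)|)] at h
    have hn : √(∑ i, L.symm v i ^ 2) = ‖v‖ := by
      rw [← L.symm.norm_map v, EuclideanSpace.norm_eq]
      simp
    rw [hn] at h
    refine le_trans (le_of_eq ?_) h
    simp [PiLp.inner_apply, stdCenter, mul_comm]

lemma integral_abs_sub_integral_le {α : Type*} [MeasurableSpace α] {P : Measure α}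
    [IsProbabilityMeasure P] {l R : α → ℝ} (hl : Integrable l P) (hR : Integrable R P)
    (hl0 : ∫ x, l x ∂P = 0) (k : ℝ) :
    ∫ x, |l x + R x + k - ∫ y, l y + R y + k ∂P| ∂P ≤ ∫ x, |l x| ∂P + 2 * ∫ x, |R x| ∂P := by
  have hmean : ∫ y, l y + R y + k ∂P = ∫ y, R y ∂P + k := by
    rw [integral_add (f := fun y => l y + R y) (hl.add hR) (integrable_const k),
      integral_add hl hR, hl0]
    simp
  rw [hmean]
  calc ∫ x, |l x + R x + k - (∫ y, R y ∂P + k)| ∂P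
      ≤ ∫ x, (|l x| + |R x| + |∫ y, R y ∂P|) ∂P := by
        refine integral_mono ?_ ?_ fun x => ?_
        · exact (((hl.add hR).add (integrable_const k)).sub (integrable_const _)).abs
        · exact (hl.abs.add hR.abs).add (integrable_const _)
        · simp only
          have e : l x + R x + k - (∫ y, R y ∂P + k) = l x + R x + -∫ y, R y ∂P := by ring
          rw [e, ← abs_neg (∫ y, R y ∂P)]
          exact abs_add_three _ _ _
    _ = ∫ x, |l x| ∂P + ∫ x, |R x| ∂P + |∫ y, R y ∂P| := by
        rw [integral_add (f := fun y => |l y| + |R y|) (hl.abs.add hR.abs) (integrable_const _),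
          integral_add hl.abs hR.abs]
        simp
    _ ≤ _ := by
        have := abs_integral_le_integral_abs (f := R) (μ := P)
        linarith

/-- Mean oscillation on a cube, compared with a first-order expansion at an arbitrary point. -/
lemma IsCube.average_abs_sub_average_le {n : ℕ} {ε : ℝ} {Q : Set (EuclideanSpace ℝ (Fin n))}
    (hQ : IsCube n ε Q) (hε : 0 < ε) {g : EuclideanSpace ℝ (Fin n) → ℝ} (hg : Continuous g)
    (v y : EuclideanSpace ℝ (Fin n)) :
    ⨍ x in Q, |g x - ⨍ z in Q, g z| ≤
      ε / 4 * ‖v‖ + 2 * ⨍ x in Q, |g x - g y - inner ℝ v (x - y)| := by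
  obtain ⟨c, hc⟩ := hQ.exists_center hε
  obtain ⟨hc0, hc1⟩ := hc v
  have hvol := hQ.volume_eq hε
  have hne : volume.restrict Q ≠ 0 := by
    rw [Ne, Measure.restrict_eq_zero, hvol]
    simp [hε]
  have : NeZero (volume.restrict Q) := ⟨hne⟩
  have : IsFiniteMeasure (volume.restrict Q) := ⟨by simp [hvol]⟩
  set P := ((volume.restrict Q) Set.univ)⁻¹ • volume.restrict Q with hP
  have hint : ∀ h : EuclideanSpace ℝ (Fin n) → ℝ, Continuous h → Integrable h P := fun h hh =>
    (hQ.integrableOn hε hh).to_average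
  have key := integral_abs_sub_integral_le (P := P) (l := fun x => inner ℝ v (x - c))
    (R := fun x => g x - g y - inner ℝ v (x - y)) (hint _ (by fun_prop)) (hint _ (by fun_prop))
    hc0 (g y + inner ℝ v (c - y))
  have hdec : ∀ x, inner ℝ v (x - c) + (g x - g y - inner ℝ v (x - y)) +
      (g y + inner ℝ v (c - y)) = g x := by
    intro x; simp only [inner_sub_right]; ring
  simp only [hdec] at key
  exact key.trans (add_le_add_left hc1 _)

lemma enorm_taylor_remainder_le {n : ℕ} {g : EuclideanSpace ℝ (Fin n) → ℝ}
    {G : EuclideanSpace ℝ (Fin n) → EuclideanSpace ℝ (Fin n)} (hG : Continuous G)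
    (hgG : ∀ x, HasGradientAt g (G x) x) (y h : EuclideanSpace ℝ (Fin n)) :
    ‖g (y + h) - g y - inner ℝ (G y) h‖ₑ ≤
      ‖h‖ₑ * ∫⁻ t in Set.Ioc (0 : ℝ) 1, ‖G (y + t • h) - G y‖ₑ := by
  have hd : ∀ t : ℝ, HasDerivAt (fun t : ℝ => g (y + t • h)) (inner ℝ (G (y + t • h)) h) t := by
    intro t
    have h1 : HasDerivAt (fun t : ℝ => y + t • h) h t := by
      simpa using ((hasDerivAt_id t).smul_const h).const_add y
    exact ((hgG (y + t • h)).hasFDerivAt.comp_hasDerivAt t h1).congr_deriv (by simp)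
  have hint := intervalIntegral.integral_eq_sub_of_hasDerivAt (a := 0) (b := 1)
    (fun t _ => hd t) (by apply Continuous.intervalIntegrable; fun_prop)
  have hrep : g (y + h) - g y - inner ℝ (G y) h =
      ∫ t in Set.Ioc (0 : ℝ) 1, inner ℝ (G (y + t • h) - G y) h := by
    rw [← intervalIntegral.integral_of_le zero_le_one]
    simp only [inner_sub_left]
    rw [intervalIntegral.integral_sub (by apply Continuous.intervalIntegrable; fun_prop)
      (by apply Continuous.intervalIntegrable; fun_prop), hint]
    simp
  rw [hrep, ← lintegral_const_mul _ (by apply Continuous.measurable; fun_prop)]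
  refine (enorm_integral_le_lintegral_enorm _).trans (lintegral_mono fun t => ?_)
  rw [mul_comm]
  simp only [← ofReal_norm]
  rw [← ENNReal.ofReal_mul (norm_nonneg _)]
  exact ENNReal.ofReal_le_ofReal (norm_inner_le_norm _ _)

lemma lintegral_taylor_remainder_le {n : ℕ} {g : EuclideanSpace ℝ (Fin n) → ℝ}
    {G : EuclideanSpace ℝ (Fin n) → EuclideanSpace ℝ (Fin n)} (hG : Continuous G)
    (hgG : ∀ x, HasGradientAt g (G x) x) {r : ℝ} {η : ℝ≥0∞}
    (hη : ∀ h : EuclideanSpace ℝ (Fin n), ‖h‖ ≤ r → ∫⁻ y, ‖G (y + h) - G y‖ₑ ≤ η) :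
    ∫⁻ y, ∫⁻ h in Metric.closedBall 0 r, ‖g (y + h) - g y - inner ℝ (G y) h‖ₑ ≤
      ENNReal.ofReal r * η * volume (Metric.closedBall (0 : EuclideanSpace ℝ (Fin n)) r) := by
  have hgc : Continuous g := continuous_iff_continuousAt.2 fun x => (hgG x).hasFDerivAt.continuousAt
  rw [lintegral_lintegral_swap (by apply Continuous.aemeasurable; unfold Function.uncurry; fun_prop)]
  rw [← setLIntegral_const]
  refine setLIntegral_mono' measurableSet_closedBall fun h hh => ?_
  have hhr : ‖h‖ ≤ r := by simpa using hh
  calc ∫⁻ y, ‖g (y + h) - g y - inner ℝ (G y) h‖ₑ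
      ≤ ∫⁻ y, ‖h‖ₑ * ∫⁻ t in Set.Ioc (0 : ℝ) 1, ‖G (y + t • h) - G y‖ₑ :=
        lintegral_mono fun y => enorm_taylor_remainder_le hG hgG y h
    _ = ‖h‖ₑ * ∫⁻ y, ∫⁻ t in Set.Ioc (0 : ℝ) 1, ‖G (y + t • h) - G y‖ₑ :=
        lintegral_const_mul' _ _ enorm_ne_top
    _ = ‖h‖ₑ * ∫⁻ t in Set.Ioc (0 : ℝ) 1, ∫⁻ y, ‖G (y + t • h) - G y‖ₑ := by
        rw [lintegral_lintegral_swap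
          (by apply Continuous.aemeasurable; unfold Function.uncurry; fun_prop)]
    _ ≤ ‖h‖ₑ * ∫⁻ t in Set.Ioc (0 : ℝ) 1, η := by
        refine mul_le_mul_right ?_ _
        refine setLIntegral_mono' measurableSet_Ioc fun t ht => hη _ ?_
        rw [norm_smul, Real.norm_of_nonneg ht.1.le]
        exact (mul_le_of_le_one_left (norm_nonneg h) ht.2).trans hhr
    _ ≤ ENNReal.ofReal r * η := by
        rw [setLIntegral_const, ← ofReal_norm]
        simp only [Real.volume_Ioc, sub_zero, ENNReal.ofReal_one, mul_one]
        gcongr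

lemma IsCube.ofReal_mul_oscillation_le {n : ℕ} (hn : 1 ≤ n) {ε : ℝ}
    {Q : Set (EuclideanSpace ℝ (Fin n))}
    (hQ : IsCube n ε Q) (hε : 0 < ε) {g : EuclideanSpace ℝ (Fin n) → ℝ} (hg : Continuous g)
    (G : EuclideanSpace ℝ (Fin n) → EuclideanSpace ℝ (Fin n)) :
    ENNReal.ofReal (ε ^ (n - 1)) * ENNReal.ofReal (⨍ x in Q, |g x - ⨍ z in Q, g z|) ≤
      ∫⁻ y in Q, (‖G y‖ₑ / 4 + ENNReal.ofReal (2 * (ε ^ (n + 1))⁻¹) *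
        ∫⁻ h in Metric.closedBall 0 (√n * ε), ‖g (y + h) - g y - inner ℝ (G y) h‖ₑ) := by
  have hvol := hQ.volume_eq hε
  have hpow : ε ^ (n - 1) = ε⁻¹ * ε ^ n := by
    obtain ⟨m, rfl⟩ : ∃ m, n = m + 1 := ⟨n - 1, by omega⟩
    simp only [Nat.add_sub_cancel, pow_succ]
    field_simp
  have hconst : ENNReal.ofReal (ε ^ (n - 1)) * ENNReal.ofReal (⨍ x in Q, |g x - ⨍ z in Q, g z|) =
      ∫⁻ _y in Q, ENNReal.ofReal (ε⁻¹ * ⨍ x in Q, |g x - ⨍ z in Q, g z|) := by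
    rw [setLIntegral_const, hvol, hpow, ENNReal.ofReal_mul (by positivity),
      ENNReal.ofReal_mul (by positivity)]
    ring
  rw [hconst]
  refine setLIntegral_mono' hQ.isOpen.measurableSet fun y hy => ?_
  have h1 := hQ.average_abs_sub_average_le hε hg (G y) y
  have h2 : ε⁻¹ * ⨍ x in Q, |g x - ⨍ z in Q, g z| ≤ ‖G y‖ / 4 +
      2 * (ε ^ (n + 1))⁻¹ * ∫ x in Q, ‖g x - g y - inner ℝ (G y) (x - y)‖ := by
    have e : ‖G y‖ / 4 + 2 * (ε ^ (n + 1))⁻¹ * ∫ x in Q, ‖g x - g y - inner ℝ (G y) (x - y)‖ =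
      ε⁻¹ * (ε / 4 * ‖G y‖ + 2 * ⨍ x in Q, |g x - g y - inner ℝ (G y) (x - y)|) := by
      rw [setAverage_eq, measureReal_def, hvol, ENNReal.toReal_ofReal (by positivity), smul_eq_mul]
      simp only [Real.norm_eq_abs]
      generalize (∫ x in Q, _ : ℝ) = I
      field_simp
      ring
    rw [e]
    gcongr
  refine (ENNReal.ofReal_le_ofReal h2).trans ?_
  rw [ENNReal.ofReal_add (by positivity) (by positivity), ENNReal.ofReal_mul (by positivity),
    ENNReal.ofReal_div_of_pos (by norm_num), ofReal_norm,
    ofReal_integral_norm_eq_lintegral_enorm (hQ.integrableOn hε (by fun_prop))]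
  have h4 : ENNReal.ofReal 4 = 4 := by norm_num
  rw [h4]
  refine add_le_add_right (mul_le_mul_right ?_ _) _
  have hpre : (fun h => y + h) ⁻¹' Q ⊆ Metric.closedBall 0 (√n * ε) := by
    intro h hh
    have := hQ.dist_le hε hh hy
    simpa using this
  calc ∫⁻ x in Q, ‖g x - g y - inner ℝ (G y) (x - y)‖ₑ
      = ∫⁻ h in (fun h => y + h) ⁻¹' Q, ‖g (y + h) - g y - inner ℝ (G y) (y + h - y)‖ₑ :=
        ((measurePreserving_add_left volume y).setLIntegral_comp_preimage_emb
          (measurableEmbedding_addLeft y)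
          (fun x => ‖g x - g y - inner ℝ (G y) (x - y)‖ₑ) Q).symm
    _ ≤ _ := by
        simp only [add_sub_cancel_left]
        exact lintegral_mono_set hpre

/-- The constant controlling the error term in the energy estimate for differentiable functions. -/
noncomputable def errorConst (n : ℕ) : ℝ≥0∞ :=
  ENNReal.ofReal (2 * √n ^ (n + 1)) * volume (Metric.ball (0 : EuclideanSpace ℝ (Fin n)) 1)

lemma errorConst_ne_top (n : ℕ) : errorConst n ≠ ⊤ :=
  ENNReal.mul_ne_top ENNReal.ofReal_ne_top measure_ball_lt_top.ne

lemma K_le_of_hasGradientAt {n : ℕ} (hn : 1 ≤ n) {ε : ℝ} (hε : 0 < ε)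
    {g : EuclideanSpace ℝ (Fin n) → ℝ}
    {G : EuclideanSpace ℝ (Fin n) → EuclideanSpace ℝ (Fin n)} (hG : Continuous G)
    (hgG : ∀ x, HasGradientAt g (G x) x) {η : ℝ≥0∞}
    (hη : ∀ h : EuclideanSpace ℝ (Fin n), ‖h‖ ≤ √n * ε → ∫⁻ y, ‖G (y + h) - G y‖ₑ ≤ η) :
    K n ε g ≤ (∫⁻ y, ‖G y‖ₑ) / 4 + errorConst n * η := by
  have hgc : Continuous g := continuous_iff_continuousAt.2 fun x => (hgG x).hasFDerivAt.continuousAt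
  refine iSup_le fun H => iSup_le fun hHc => iSup_le fun hHQ => iSup_le fun hHd => ?_
  rw [← ENNReal.tsum_mul_left]
  calc ∑' Q : H, ENNReal.ofReal (ε ^ (n - 1)) *
        ENNReal.ofReal (⨍ x in (Q : Set (EuclideanSpace ℝ (Fin n))),
          |g x - ⨍ y in (Q : Set (EuclideanSpace ℝ (Fin n))), g y|)
      ≤ ∑' Q : H, ∫⁻ y in (Q : Set (EuclideanSpace ℝ (Fin n))),
        (‖G y‖ₑ / 4 + ENNReal.ofReal (2 * (ε ^ (n + 1))⁻¹) *
        ∫⁻ h in Metric.closedBall 0 (√n * ε), ‖g (y + h) - g y - inner ℝ (G y) h‖ₑ) :=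
        ENNReal.tsum_le_tsum fun Q => (hHQ Q Q.2).ofReal_mul_oscillation_le hn hε hgc G
    _ = ∫⁻ y in ⋃ Q ∈ H, Q, (‖G y‖ₑ / 4 + ENNReal.ofReal (2 * (ε ^ (n + 1))⁻¹) *
        ∫⁻ h in Metric.closedBall 0 (√n * ε), ‖g (y + h) - g y - inner ℝ (G y) h‖ₑ) :=
        (lintegral_biUnion hHc (s := id) (fun Q hQ => (hHQ Q hQ).isOpen.measurableSet) hHd _).symm
    _ ≤ ∫⁻ y, (‖G y‖ₑ / 4 + ENNReal.ofReal (2 * (ε ^ (n + 1))⁻¹) *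
        ∫⁻ h in Metric.closedBall 0 (√n * ε), ‖g (y + h) - g y - inner ℝ (G y) h‖ₑ) :=
        setLIntegral_le_lintegral _ _
    _ = (∫⁻ y, ‖G y‖ₑ) / 4 + ENNReal.ofReal (2 * (ε ^ (n + 1))⁻¹) *
        ∫⁻ y, ∫⁻ h in Metric.closedBall 0 (√n * ε), ‖g (y + h) - g y - inner ℝ (G y) h‖ₑ := by
        rw [lintegral_add_left (by fun_prop), lintegral_const_mul' _ _ ENNReal.ofReal_ne_top]
        simp only [div_eq_mul_inv]
        rw [lintegral_mul_const' _ _ (by simp)]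
    _ ≤ (∫⁻ y, ‖G y‖ₑ) / 4 + ENNReal.ofReal (2 * (ε ^ (n + 1))⁻¹) *
        (ENNReal.ofReal (√n * ε) * η *
          volume (Metric.closedBall (0 : EuclideanSpace ℝ (Fin n)) (√n * ε))) := by
        gcongr
        exact lintegral_taylor_remainder_le hG hgG hη
    _ = (∫⁻ y, ‖G y‖ₑ) / 4 + errorConst n * η := by
        congr 1
        rw [Measure.addHaar_closedBall _ _ (by positivity), finrank_euclideanSpace_fin, errorConst]
        have : 2 * √n ^ (n + 1) = 2 * (ε ^ (n + 1))⁻¹ * (√n * ε) * (√n * ε) ^ n := by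
          field_simp
          ring
        rw [this, ENNReal.ofReal_mul (q := (√n * ε) ^ n) (by positivity),
          ENNReal.ofReal_mul (q := √n * ε) (by positivity)]
        ring

lemma tendsto_lintegral_translate_sub {n : ℕ} {X : Type*} [NormedAddCommGroup X]
    {F : EuclideanSpace ℝ (Fin n) → X} (hF : Integrable F) :
    Tendsto (fun h : EuclideanSpace ℝ (Fin n) => ∫⁻ y, ‖F (y + h) - F y‖ₑ) (𝓝 0) (𝓝 0) := by
  have hL : MemLp F 1 volume := memLp_one_iff_integrable.2 hF
  let τ : C(EuclideanSpace ℝ (Fin n), C(EuclideanSpace ℝ (Fin n), EuclideanSpace ℝ (Fin n))) :=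
    (ContinuousMap.mk (fun p : EuclideanSpace ℝ (Fin n) × EuclideanSpace ℝ (Fin n) => p.2 + p.1)
      (by fun_prop)).curry
  have hτ : ∀ h, MeasurePreserving (τ h) volume volume := fun h =>
    measurePreserving_add_right volume h
  have hcont := (continuous_const (y := hL.toLp F)).compMeasurePreservingLp τ.continuous hτ
    ENNReal.one_ne_top
  have h0 : Lp.compMeasurePreserving (τ 0) (hτ 0) (hL.toLp F) = hL.toLp F := by
    rw [Lp.toLp_compMeasurePreserving]
    congr 1
    ext y
    simp [τ]
  have := tendsto_iff_edist_tendsto_0.1 (hcont.tendsto 0)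
  rw [h0] at this
  refine this.congr fun h => ?_
  rw [Lp.toLp_compMeasurePreserving, Lp.edist_toLp_toLp, eLpNorm_one_eq_lintegral_enorm]
  rfl

lemma lintegral_enorm_normed_convolution_sub_le {n : ℕ} {F : EuclideanSpace ℝ (Fin n) → ℝ}
    (hF : Integrable F) (φ : ContDiffBump (0 : EuclideanSpace ℝ (Fin n))) {η : ℝ≥0∞}
    (hη : ∀ h : EuclideanSpace ℝ (Fin n), ‖h‖ ≤ φ.rOut → ∫⁻ y, ‖F (y + h) - F y‖ₑ ≤ η) :
    ∫⁻ x, ‖convolution (φ.normed volume) F (ContinuousLinearMap.lsmul ℝ ℝ) volume x - F x‖ₑ ≤ η := by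
  have hφ1 : ∫⁻ t, ‖φ.normed volume t‖ₑ = 1 := by
    rw [← ofReal_integral_norm_eq_lintegral_enorm φ.integrable_normed]
    simp only [Real.norm_of_nonneg (φ.nonneg_normed _), φ.integral_normed, ENNReal.ofReal_one]
  have hpt : ∀ x, ‖convolution (φ.normed volume) F (ContinuousLinearMap.lsmul ℝ ℝ) volume x - F x‖ₑ
      ≤ ∫⁻ t, ‖φ.normed volume t‖ₑ * ‖F (x - t) - F x‖ₑ := by
    intro x
    have hex : ConvolutionExistsAt (φ.normed volume) F x (ContinuousLinearMap.lsmul ℝ ℝ) volume :=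
      φ.hasCompactSupport_normed.convolutionExists_left _ φ.continuous_normed
        hF.locallyIntegrable x
    have e : convolution (φ.normed volume) F (ContinuousLinearMap.lsmul ℝ ℝ) volume x - F x =
        ∫ t, φ.normed volume t * (F (x - t) - F x) := by
      simp only [mul_sub]
      rw [integral_sub (f := fun t => φ.normed volume t * F (x - t)) hex
        (φ.integrable_normed.mul_const _), integral_mul_const,
        φ.integral_normed, one_mul]
      rfl
    rw [e]
    refine (enorm_integral_le_lintegral_enorm _).trans (le_of_eq ?_)
    simp only [enorm_mul]
  have hmeas : AEMeasurable (Function.uncurry fun x t : EuclideanSpace ℝ (Fin n) =>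
      ‖φ.normed volume t‖ₑ * ‖F (x - t) - F x‖ₑ) (volume.prod volume) := by
    have h1 : AEStronglyMeasurable (fun p : EuclideanSpace ℝ (Fin n) × EuclideanSpace ℝ (Fin n) =>
        F (p.1 - p.2)) (volume.prod volume) :=
      hF.aestronglyMeasurable.comp_quasiMeasurePreserving (quasiMeasurePreserving_sub _ _)
    have h2 : AEStronglyMeasurable (fun p : EuclideanSpace ℝ (Fin n) × EuclideanSpace ℝ (Fin n) =>
        F p.1) (volume.prod volume) := hF.aestronglyMeasurable.comp_fst
    have h3 : Continuous (fun p : EuclideanSpace ℝ (Fin n) × EuclideanSpace ℝ (Fin n) =>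
        ‖φ.normed volume p.2‖ₑ) := (φ.continuous_normed.comp continuous_snd).enorm
    exact h3.aemeasurable.mul (h1.sub h2).enorm
  calc ∫⁻ x, ‖convolution (φ.normed volume) F (ContinuousLinearMap.lsmul ℝ ℝ) volume x - F x‖ₑ
      ≤ ∫⁻ x, ∫⁻ t, ‖φ.normed volume t‖ₑ * ‖F (x - t) - F x‖ₑ := lintegral_mono hpt
    _ = ∫⁻ t, ∫⁻ x, ‖φ.normed volume t‖ₑ * ‖F (x - t) - F x‖ₑ := lintegral_lintegral_swap hmeas
    _ ≤ ∫⁻ t, ‖φ.normed volume t‖ₑ * η := by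
        refine lintegral_mono fun t => ?_
        rw [lintegral_const_mul' _ _ enorm_ne_top]
        by_cases ht : φ.normed volume t = 0
        · simp [ht]
        · refine mul_le_mul_right ?_ _
          have hts : t ∈ Function.support (φ.normed volume) := ht
          rw [φ.support_normed_eq, mem_ball_zero_iff] at hts
          simpa [sub_eq_add_neg] using hη (-t) (by simpa using hts.le)
    _ = η := by
        rw [lintegral_mul_const _ φ.continuous_normed.enorm.measurable, hφ1, one_mul]

/-- A sequence of bump functions with supports shrinking to the origin. -/
noncomputable def bumpSeq (n k : ℕ) : ContDiffBump (0 : EuclideanSpace ℝ (Fin n)) where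
  rIn := 1 / (k + 2)
  rOut := 1 / (k + 1)
  rIn_pos := by positivity
  rIn_lt_rOut := by
    apply one_div_lt_one_div_of_lt <;> linarith [(Nat.cast_nonneg k : (0 : ℝ) ≤ k)]

/-- The mollification of `f` at scale `1 / (k + 1)`. -/
noncomputable def mollify {n : ℕ} (f : EuclideanSpace ℝ (Fin n) → ℝ) (k : ℕ) :
    EuclideanSpace ℝ (Fin n) → ℝ :=
  convolution ((bumpSeq n k).normed volume) f (ContinuousLinearMap.lsmul ℝ ℝ) volume

lemma contDiff_mollify {n : ℕ} {f : EuclideanSpace ℝ (Fin n) → ℝ} (hf : LocallyIntegrable f)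
    (k : ℕ) : ContDiff ℝ 2 (mollify f k) :=
  (bumpSeq n k).hasCompactSupport_normed.contDiff_convolution_left (n := 2) _
    (bumpSeq n k).contDiff_normed hf

lemma tendsto_lintegral_mollify_sub {n : ℕ} {F : EuclideanSpace ℝ (Fin n) → ℝ}
    (hF : Integrable F) :
    Tendsto (fun k => ∫⁻ x, ‖mollify F k x - F x‖ₑ) atTop (𝓝 0) := by
  rw [ENNReal.tendsto_nhds_zero]
  intro η hη
  have h1 := ENNReal.tendsto_nhds_zero.1 (tendsto_lintegral_translate_sub hF) η hη
  obtain ⟨r, hr, hball⟩ := Metric.eventually_nhds_iff_ball.1 h1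
  have h2 : ∀ᶠ k : ℕ in atTop, 1 / ((k : ℝ) + 1) < r :=
    (tendsto_order.1 tendsto_one_div_add_atTop_nhds_zero_nat).2 r hr
  filter_upwards [h2] with k hk
  refine lintegral_enorm_normed_convolution_sub_le hF _ fun h hh => hball h ?_
  rw [mem_ball_zero_iff]
  exact lt_of_le_of_lt hh hk

lemma tendsto_setIntegral_mollify_sub {n : ℕ} {f : EuclideanSpace ℝ (Fin n) → ℝ}
    (hf : LocallyIntegrable f) {C : Set (EuclideanSpace ℝ (Fin n))} (hC : IsCompact C) :
    Tendsto (fun k => ∫ x in C, |mollify f k x - f x|) atTop (𝓝 0) := by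
  set C' := Metric.cthickening 1 C with hC'
  have hC'c : IsCompact C' := hC.cthickening
  set F := C'.indicator f with hFdef
  have hF : Integrable F :=
    (integrable_indicator_iff hC'c.measurableSet).2 (hf.integrableOn_isCompact hC'c)
  have heq : ∀ k, ∀ x ∈ C, mollify f k x - f x = mollify F k x - F x := by
    intro k x hx
    have hmem : ∀ t : EuclideanSpace ℝ (Fin n), ‖t‖ ≤ 1 → x - t ∈ C' := fun t ht =>
      Metric.mem_cthickening_of_dist_le _ x 1 C hx (by simpa using ht)
    congr 1
    · unfold mollify convolution
      congr 1
      ext t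
      by_cases ht : (bumpSeq n k).normed volume t = 0
      · simp [ht]
      · have hts : t ∈ Function.support ((bumpSeq n k).normed volume) := ht
        rw [ContDiffBump.support_normed_eq, mem_ball_zero_iff] at hts
        have h1 : (bumpSeq n k).rOut ≤ 1 := by
          simp only [bumpSeq]
          rw [div_le_one (by positivity)]
          linarith [(Nat.cast_nonneg k : (0 : ℝ) ≤ k)]
        rw [hFdef, Set.indicator_of_mem (hmem t (hts.le.trans h1))]
    · rw [hFdef, Set.indicator_of_mem (by simpa using hmem 0 (by simp))]
  have hreal := (ENNReal.tendsto_toReal ENNReal.zero_ne_top).comp (tendsto_lintegral_mollify_sub hF)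
  rw [ENNReal.toReal_zero] at hreal
  have hev : ∀ᶠ k in atTop, ∫⁻ x, ‖mollify F k x - F x‖ₑ ≤ 1 :=
    ENNReal.tendsto_nhds_zero.1 (tendsto_lintegral_mollify_sub hF) 1 one_pos
  refine squeeze_zero' (Eventually.of_forall fun k => integral_nonneg fun x => abs_nonneg _) ?_ hreal
  filter_upwards [hev] with k hk
  rw [setIntegral_congr_fun hC.measurableSet
    (fun x hx => by rw [heq k x hx] : Set.EqOn _ (fun x => |mollify F k x - F x|) C)]
  have hm : AEStronglyMeasurable (fun x => mollify F k x - F x) volume :=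
    (contDiff_mollify hF.locallyIntegrable k).continuous.aestronglyMeasurable.sub
      hF.aestronglyMeasurable
  simp only [Function.comp_def, ← Real.norm_eq_abs]
  rw [integral_norm_eq_lintegral_enorm hm.restrict]
  exact ENNReal.toReal_mono (ne_top_of_le_ne_top ENNReal.one_ne_top hk)
    (setLIntegral_le_lintegral _ _)

/-- The trace of an endomorphism of `ℝ^n`, as a continuous linear functional. -/
noncomputable def traceCLM (n : ℕ) :
    (EuclideanSpace ℝ (Fin n) →L[ℝ] EuclideanSpace ℝ (Fin n)) →L[ℝ] ℝ :=
  ∑ i, (EuclideanSpace.proj i : EuclideanSpace ℝ (Fin n) →L[ℝ] ℝ).comp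
    (ContinuousLinearMap.apply ℝ (EuclideanSpace ℝ (Fin n)) (EuclideanSpace.single i (1 : ℝ)))

lemma div'_eq_traceCLM {n : ℕ} (ψ : EuclideanSpace ℝ (Fin n) → EuclideanSpace ℝ (Fin n)) :
    div' ψ = fun x => traceCLM n (fderiv ℝ ψ x) := by
  ext x
  simp [div', traceCLM]

lemma continuous_div' {n : ℕ} {ψ : EuclideanSpace ℝ (Fin n) → EuclideanSpace ℝ (Fin n)}
    (hψ : ContDiff ℝ 1 ψ) : Continuous (div' ψ) := by
  rw [div'_eq_traceCLM]
  exact (traceCLM n).continuous.comp (hψ.continuous_fderiv one_ne_zero)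

lemma hasCompactSupport_div' {n : ℕ} {ψ : EuclideanSpace ℝ (Fin n) → EuclideanSpace ℝ (Fin n)}
    (hψ : HasCompactSupport ψ) : HasCompactSupport (div' ψ) := by
  rw [div'_eq_traceCLM]
  exact (hψ.fderiv ℝ).comp_left (g := traceCLM n) (map_zero _)

/-- Integration by parts. -/
lemma integral_inner_gradient_eq_neg {n : ℕ} {g : EuclideanSpace ℝ (Fin n) → ℝ}
    (hg : ContDiff ℝ 1 g) {ψ : EuclideanSpace ℝ (Fin n) → EuclideanSpace ℝ (Fin n)}
    (hψ : ContDiff ℝ 1 ψ) (hψc : HasCompactSupport ψ) :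
    ∫ x, inner ℝ (gradient g x) (ψ x) = -∫ x, g x * div' ψ x := by
  have hgd := hg.continuous_fderiv one_ne_zero
  have hψd := hψ.continuous_fderiv one_ne_zero
  have hgc := hg.continuous
  have hψcont := hψ.continuous
  have hinner : ∀ x, inner ℝ (gradient g x) (ψ x) =
      ∑ i, fderiv ℝ g x (EuclideanSpace.single i 1) * ψ x i := by
    intro x
    have h1 : inner ℝ (gradient g x) (ψ x) = fderiv ℝ g x (ψ x) := by
      simp [gradient]
    rw [h1]
    conv_lhs => rw [← (EuclideanSpace.basisFun (Fin n) ℝ).sum_repr (ψ x)]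
    simp [mul_comm]
  have hcoord : ∀ i x, fderiv ℝ (fun x => ψ x i) x (EuclideanSpace.single i 1) =
      fderiv ℝ ψ x (EuclideanSpace.single i 1) i := by
    intro i x
    have := ((EuclideanSpace.proj i : EuclideanSpace ℝ (Fin n) →L[ℝ] ℝ).hasFDerivAt.comp x
      ((hψ.differentiable one_ne_zero) x).hasFDerivAt).fderiv
    have e : (fun x => ψ x i) = (EuclideanSpace.proj i : EuclideanSpace ℝ (Fin n) →L[ℝ] ℝ) ∘ ψ := rfl
    rw [e, this]
    rfl
  have hψi : ∀ i, HasCompactSupport fun x => ψ x i := fun i =>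
    hψc.comp_left (g := fun v : EuclideanSpace ℝ (Fin n) => v i) rfl
  have hψdi : ∀ i, HasCompactSupport fun x => fderiv ℝ ψ x (EuclideanSpace.single i 1) i := fun i =>
    (hψc.fderiv ℝ).comp_left
      (g := fun A : EuclideanSpace ℝ (Fin n) →L[ℝ] EuclideanSpace ℝ (Fin n) =>
        A (EuclideanSpace.single i 1) i) (by simp)
  have hI1 : ∀ i, Integrable fun x => fderiv ℝ g x (EuclideanSpace.single i 1) * ψ x i := fun i =>
    Continuous.integrable_of_hasCompactSupport (by fun_prop) (hψi i).mul_left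
  have hI2 : ∀ i, Integrable fun x => g x * fderiv ℝ ψ x (EuclideanSpace.single i 1) i := fun i =>
    Continuous.integrable_of_hasCompactSupport (by fun_prop) (hψdi i).mul_left
  have hI3 : ∀ i, Integrable fun x => g x * ψ x i := fun i =>
    Continuous.integrable_of_hasCompactSupport (by fun_prop) (hψi i).mul_left
  simp only [hinner, div', Finset.mul_sum]
  rw [integral_finsetSum _ fun i _ => hI1 i, integral_finsetSum _ fun i _ => hI2 i,
    ← Finset.sum_neg_distrib]
  refine Finset.sum_congr rfl fun i _ => ?_
  have := integral_mul_fderiv_eq_neg_fderiv_mul_of_integrable (f := g) (g := fun x => ψ x i)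
    (v := EuclideanSpace.single i (1 : ℝ)) (μ := volume) (hI1 i) (by simpa only [hcoord] using hI2 i)
    (hI3 i) (fun x _ => hg.differentiable one_ne_zero x)
    (fun x _ => ((EuclideanSpace.proj i : EuclideanSpace ℝ (Fin n) →L[ℝ] ℝ).differentiableAt.comp x
      (hψ.differentiable one_ne_zero x)))
  simp only [hcoord] at this
  rw [this, neg_neg]

/-- Convolution with an even compactly supported kernel is symmetric. -/
lemma integral_convolution_mul {n : ℕ} {f ρ D : EuclideanSpace ℝ (Fin n) → ℝ}
    (hf : LocallyIntegrable f) (hρ : Continuous ρ) (hρc : HasCompactSupport ρ)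
    (hρe : ∀ x, ρ (-x) = ρ x) (hD : Continuous D) (hDc : HasCompactSupport D) :
    ∫ x, convolution ρ f (ContinuousLinearMap.lsmul ℝ ℝ) volume x * D x =
      ∫ z, f z * convolution ρ D (ContinuousLinearMap.lsmul ℝ ℝ) volume z := by
  have hconv : ∀ (h : EuclideanSpace ℝ (Fin n) → ℝ) x,
      convolution ρ h (ContinuousLinearMap.lsmul ℝ ℝ) volume x = ∫ z, ρ (x - z) * h z := by
    intro h x
    rw [convolution_eq_swap]
    rfl
  simp only [hconv, ← integral_mul_const, ← integral_const_mul]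
  set S := (fun p : EuclideanSpace ℝ (Fin n) × EuclideanSpace ℝ (Fin n) => p.1 - p.2) ''
    (tsupport D ×ˢ tsupport ρ)
  have hSc : IsCompact S := (hDc.isCompact.prod hρc.isCompact).image continuous_sub
  have hfS : Integrable (S.indicator f) :=
    (integrable_indicator_iff hSc.measurableSet).2 (hf.integrableOn_isCompact hSc)
  obtain ⟨B, hB⟩ := hρ.bounded_above_of_compact_support hρc
  have hint : Integrable (Function.uncurry fun x z => ρ (x - z) * f z * D x)
      (volume.prod volume) := by
    have h1 : Integrable (fun p : EuclideanSpace ℝ (Fin n) × EuclideanSpace ℝ (Fin n) =>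
        ρ (p.1 - p.2) * (D p.1 * S.indicator f p.2)) (volume.prod volume) :=
      ((hD.integrable_of_hasCompactSupport hDc).mul_prod hfS).bdd_mul (c := B)
        (by apply Continuous.aestronglyMeasurable; fun_prop) (Eventually.of_forall fun p => hB _)
    refine h1.congr (Eventually.of_forall fun p => ?_)
    obtain ⟨x, z⟩ := p
    simp only [Function.uncurry]
    by_cases hDx : D x = 0
    · simp [hDx]
    by_cases hρx : ρ (x - z) = 0
    · simp [hρx]
    have hz : z ∈ S :=
      ⟨(x, x - z), ⟨subset_tsupport _ hDx, subset_tsupport _ hρx⟩, sub_sub_cancel x z⟩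
    rw [Set.indicator_of_mem hz]
    ring
  rw [integral_integral_swap hint]
  congr 1; ext z
  congr 1; ext x
  rw [← hρe (x - z), neg_sub]
  ring

lemma div'_convolution {n : ℕ} {ρ : EuclideanSpace ℝ (Fin n) → ℝ} (hρ : Continuous ρ)
    {ψ : EuclideanSpace ℝ (Fin n) → EuclideanSpace ℝ (Fin n)}
    (hψ : ContDiff ℝ 1 ψ) (hψc : HasCompactSupport ψ) (x : EuclideanSpace ℝ (Fin n)) :
    div' (convolution ρ ψ (ContinuousLinearMap.lsmul ℝ ℝ) volume) x =
      convolution ρ (div' ψ) (ContinuousLinearMap.lsmul ℝ ℝ) volume x := by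
  have hρl : LocallyIntegrable ρ := hρ.locallyIntegrable
  have hd := hψc.hasFDerivAt_convolution_right (μ := volume)
    (ContinuousLinearMap.lsmul ℝ ℝ : ℝ →L[ℝ] EuclideanSpace ℝ (Fin n) →L[ℝ] _) hρl hψ x
  have hex := (hψc.fderiv ℝ).convolutionExists_right (μ := volume)
    (ContinuousLinearMap.precompR (EuclideanSpace ℝ (Fin n))
      (ContinuousLinearMap.lsmul ℝ ℝ : ℝ →L[ℝ] EuclideanSpace ℝ (Fin n) →L[ℝ] _))
    hρl (hψ.continuous_fderiv one_ne_zero) x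
  rw [div'_eq_traceCLM, div'_eq_traceCLM]
  simp only
  rw [hd.fderiv]
  unfold convolution
  rw [← ContinuousLinearMap.integral_comp_comm _ hex]
  congr 1; ext t
  have : ContinuousLinearMap.precompR (EuclideanSpace ℝ (Fin n))
      (ContinuousLinearMap.lsmul ℝ ℝ : ℝ →L[ℝ] EuclideanSpace ℝ (Fin n) →L[ℝ] _) (ρ t)
      (fderiv ℝ ψ (x - t)) = ρ t • fderiv ℝ ψ (x - t) := by
    ext v; simp
  rw [this, map_smul]
  simp

lemma ofReal_integral_mollify_mul_div'_le {n : ℕ} {f : EuclideanSpace ℝ (Fin n) → ℝ}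
    (hf : LocallyIntegrable f) (k : ℕ)
    {ψ : EuclideanSpace ℝ (Fin n) → EuclideanSpace ℝ (Fin n)}
    (hψ : ContDiff ℝ 1 ψ) (hψc : HasCompactSupport ψ) (hψ1 : ∀ x, ‖ψ x‖ ≤ 1) :
    ENNReal.ofReal (∫ x, mollify f k x * div' ψ x) ≤ totalVariation n f := by
  set ρ := (bumpSeq n k).normed volume with hρ
  have hρcont : Continuous ρ := (bumpSeq n k).continuous_normed
  have hρc : HasCompactSupport ρ := (bumpSeq n k).hasCompactSupport_normed
  have e : ∫ x, mollify f k x * div' ψ x =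
      ∫ z, f z * div' (convolution ρ ψ (ContinuousLinearMap.lsmul ℝ ℝ) volume) z := by
    simp only [div'_convolution hρcont hψ hψc]
    exact integral_convolution_mul hf hρcont hρc (bumpSeq n k).normed_neg (continuous_div' hψ)
      (hasCompactSupport_div' hψc)
  rw [e]
  refine le_iSup_of_le (convolution ρ ψ (ContinuousLinearMap.lsmul ℝ ℝ) volume) ?_
  refine le_iSup_of_le (hψc.contDiff_convolution_right (n := 1) _ hρcont.locallyIntegrable hψ) ?_
  refine le_iSup_of_le (HasCompactSupport.convolution _ hρc hψc) ?_
  refine le_iSup_of_le (fun x => ?_) le_rfl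
  calc ‖convolution ρ ψ (ContinuousLinearMap.lsmul ℝ ℝ) volume x‖
      ≤ ∫ t, ρ t := by
        refine norm_integral_le_of_norm_le (bumpSeq n k).integrable_normed
          (Eventually.of_forall fun t => ?_)
        simp only [ContinuousLinearMap.lsmul_apply, norm_smul]
        rw [Real.norm_of_nonneg ((bumpSeq n k).nonneg_normed t)]
        exact mul_le_of_le_one_right ((bumpSeq n k).nonneg_normed t) (hψ1 _)
    _ = 1 := (bumpSeq n k).integral_normed

lemma contDiff_gradient {n : ℕ} {g : EuclideanSpace ℝ (Fin n) → ℝ} (hg : ContDiff ℝ 2 g) :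
    ContDiff ℝ 1 (gradient g) := by
  unfold gradient
  exact (InnerProductSpace.toDual ℝ (EuclideanSpace ℝ (Fin n))).symm.contDiff.comp
    (hg.fderiv_right (by norm_num))

/-- Bump functions exhausting the whole space. -/
noncomputable def cutoffSeq (n k : ℕ) : ContDiffBump (0 : EuclideanSpace ℝ (Fin n)) where
  rIn := k + 1
  rOut := k + 2
  rIn_pos := by positivity
  rIn_lt_rOut := by linarith

/-- For a `C²` function the `L¹` norm of the gradient is bounded by the total variation. -/
lemma lintegral_gradient_le {n : ℕ} {g : EuclideanSpace ℝ (Fin n) → ℝ} (hg : ContDiff ℝ 2 g)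
    {V : ℝ≥0∞} (hV : ∀ ψ : EuclideanSpace ℝ (Fin n) → EuclideanSpace ℝ (Fin n),
      ContDiff ℝ 1 ψ → HasCompactSupport ψ → (∀ x, ‖ψ x‖ ≤ 1) →
      ENNReal.ofReal (∫ x, g x * div' ψ x) ≤ V) :
    ∫⁻ x, ‖gradient g x‖ₑ ≤ V := by
  set G := gradient g with hGdef
  have hG : ContDiff ℝ 1 G := contDiff_gradient hg
  have hGc := hG.continuous
  set w : ℕ → EuclideanSpace ℝ (Fin n) → ℝ := fun k x =>
    cutoffSeq n k x * (√(1 / ((k : ℝ) + 1) + ‖G x‖ ^ 2))⁻¹ with hw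
  have hpos : ∀ (k : ℕ) x, 0 < 1 / ((k : ℝ) + 1) + ‖G x‖ ^ 2 := fun k x => by positivity
  have hw0 : ∀ k x, 0 ≤ w k x := fun k x => mul_nonneg (cutoffSeq n k).nonneg (by positivity)
  have hwc : ∀ k, ContDiff ℝ 1 (w k) := fun k =>
    (cutoffSeq n k).contDiff.mul
      (((contDiff_const.add (hG.norm_sq ℝ)).sqrt fun x => (hpos k x).ne').inv
        fun x => (Real.sqrt_pos.2 (hpos k x)).ne')
  have hbound : ∀ k, ∫⁻ x, ENNReal.ofReal (w k x * ‖G x‖ ^ 2) ≤ V := by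
    intro k
    have hsupp : HasCompactSupport (w k) := (cutoffSeq n k).hasCompactSupport.mul_right
    have hψ : ContDiff ℝ 1 fun x => -(w k x • G x) := ((hwc k).smul hG).neg
    have hψc : HasCompactSupport fun x => -(w k x • G x) := hsupp.smul_right.neg
    have hψ1 : ∀ x, ‖-(w k x • G x)‖ ≤ 1 := by
      intro x
      rw [norm_neg, norm_smul, Real.norm_of_nonneg (hw0 k x)]
      have h1 : ‖G x‖ ≤ √(1 / ((k : ℝ) + 1) + ‖G x‖ ^ 2) :=
        Real.le_sqrt_of_sq_le (by linarith [show (0 : ℝ) ≤ 1 / ((k : ℝ) + 1) by positivity])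
      have h2 : w k x ≤ (√(1 / ((k : ℝ) + 1) + ‖G x‖ ^ 2))⁻¹ :=
        mul_le_of_le_one_left (by positivity) (cutoffSeq n k).le_one
      calc w k x * ‖G x‖ ≤ (√(1 / ((k : ℝ) + 1) + ‖G x‖ ^ 2))⁻¹ * ‖G x‖ := by gcongr
        _ ≤ 1 := by
          rw [inv_mul_le_iff₀ (Real.sqrt_pos.2 (hpos k x))]; simpa using h1
    have hibp := integral_inner_gradient_eq_neg (hg.of_le (by norm_num)) hψ hψc
    have hinner : ∀ x, inner ℝ (gradient g x) (-(w k x • G x)) = -(w k x * ‖G x‖ ^ 2) := by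
      intro x
      rw [inner_neg_right, inner_smul_right, ← hGdef, real_inner_self_eq_norm_sq]
    simp only [hinner, integral_neg, neg_inj] at hibp
    have hint : Integrable fun x => w k x * ‖G x‖ ^ 2 :=
      Continuous.integrable_of_hasCompactSupport ((hwc k).continuous.mul (by fun_prop))
        hsupp.mul_right
    rw [← ofReal_integral_eq_lintegral_ofReal hint
      (Eventually.of_forall fun x => mul_nonneg (hw0 k x) (by positivity)), hibp]
    exact hV _ hψ hψc hψ1
  have hlim : ∀ x, Tendsto (fun k => ENNReal.ofReal (w k x * ‖G x‖ ^ 2)) atTop (𝓝 ‖G x‖ₑ) := by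
    intro x
    rw [← ofReal_norm]
    refine (ENNReal.continuous_ofReal.tendsto _).comp ?_
    have h1 : ∀ᶠ k : ℕ in atTop, w k x = (√(1 / ((k : ℝ) + 1) + ‖G x‖ ^ 2))⁻¹ := by
      filter_upwards [eventually_ge_atTop ⌈‖x‖⌉₊] with k hk
      have : cutoffSeq n k x = 1 := by
        apply ContDiffBump.one_of_mem_closedBall
        rw [mem_closedBall_zero_iff]
        simp only [cutoffSeq]
        linarith [Nat.ceil_le.1 hk]
      simp [hw, this]
    have h2 : Tendsto (fun k : ℕ => √(1 / ((k : ℝ) + 1) + ‖G x‖ ^ 2)) atTop (𝓝 ‖G x‖) := by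
      have := ((tendsto_one_div_add_atTop_nhds_zero_nat (𝕜 := ℝ)).add_const (‖G x‖ ^ 2)).sqrt
      simpa using this
    by_cases hz : ‖G x‖ = 0
    · simp [hz]
    have h3 : Tendsto (fun k : ℕ => (√(1 / ((k : ℝ) + 1) + ‖G x‖ ^ 2))⁻¹ * ‖G x‖ ^ 2) atTop
        (𝓝 ‖G x‖) := by
      have := (h2.inv₀ hz).mul_const (‖G x‖ ^ 2)
      have e : ‖G x‖⁻¹ * ‖G x‖ ^ 2 = ‖G x‖ := by field_simp
      rwa [e] at this
    refine h3.congr' ?_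
    filter_upwards [h1] with k hk
    rw [hk]
  calc ∫⁻ x, ‖G x‖ₑ = ∫⁻ x, liminf (fun k => ENNReal.ofReal (w k x * ‖G x‖ ^ 2)) atTop := by
        congr 1; ext x; exact (hlim x).liminf_eq.symm
    _ ≤ liminf (fun k => ∫⁻ x, ENNReal.ofReal (w k x * ‖G x‖ ^ 2)) atTop :=
        lintegral_liminf_le fun k =>
          (((hwc k).continuous.mul (by fun_prop)).measurable).ennreal_ofReal
    _ ≤ V := liminf_le_of_le (by isBoundedDefault) fun b hb => by
        obtain ⟨k, hk⟩ := hb.exists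
        exact hk.trans (hbound k)

/-- Each mollification of a function of finite variation satisfies the sharp bound in the limit
`ε → 0`. -/
lemma eventually_K_mollify_le {n : ℕ} (hn : 1 ≤ n) {f : EuclideanSpace ℝ (Fin n) → ℝ}
    (hf : LocallyIntegrable f volume) (hV : totalVariation n f ≠ ⊤) (k : ℕ) {δ : ℝ≥0∞}
    (hδ : 0 < δ) :
    ∀ᶠ ε in 𝓝[>] (0 : ℝ), K n ε (mollify f k) ≤ totalVariation n f / 4 + δ := by
  have hg := contDiff_mollify hf k
  have hGc : Continuous (gradient (mollify f k)) := (contDiff_gradient hg).continuous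
  have hGV : ∫⁻ x, ‖gradient (mollify f k) x‖ₑ ≤ totalVariation n f :=
    lintegral_gradient_le hg fun ψ hψ hψc hψ1 =>
      ofReal_integral_mollify_mul_div'_le hf k hψ hψc hψ1
  have hGi : Integrable (gradient (mollify f k)) volume :=
    ⟨hGc.aestronglyMeasurable, hGV.trans_lt hV.lt_top⟩
  obtain ⟨η, hη, hηδ⟩ : ∃ η : ℝ≥0∞, 0 < η ∧ errorConst n * η ≤ δ := by
    have h0 : Tendsto (fun η : ℝ≥0∞ => errorConst n * η) (𝓝[>] 0) (𝓝 0) := by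
      have h := ENNReal.Tendsto.const_mul (a := errorConst n) (tendsto_id (x := 𝓝 (0 : ℝ≥0∞)))
        (Or.inr (errorConst_ne_top n))
      rw [mul_zero] at h
      exact h.mono_left nhdsWithin_le_nhds
    obtain ⟨η, h1, h2⟩ := ((h0.eventually (gt_mem_nhds hδ)).and self_mem_nhdsWithin).exists
    exact ⟨η, h2, h1.le⟩
  obtain ⟨r, hr, hball⟩ := Metric.eventually_nhds_iff.1
    ((tendsto_lintegral_translate_sub hGi).eventually (gt_mem_nhds hη))
  have hsmall : ∀ᶠ ε in 𝓝[>] (0 : ℝ), √n * ε < r := by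
    have h : Tendsto (fun ε : ℝ => √n * ε) (𝓝 0) (𝓝 0) := by
      simpa using (continuous_const_mul (√(n : ℝ))).tendsto 0
    exact (h.mono_left nhdsWithin_le_nhds).eventually (gt_mem_nhds hr)
  filter_upwards [hsmall, self_mem_nhdsWithin] with ε hε hε0
  refine (K_le_of_hasGradientAt hn hε0 hGc
    (fun x => (hg.differentiable two_ne_zero x).hasGradientAt) fun h hh =>
      (hball (by simpa using hh.trans_lt hε)).le).trans ?_
  gcongr

/-- A diagonal argument: properties that each hold eventually near `0⁺` hold along some
selection `κ ε → ∞`. -/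
lemma exists_diagonal_nhdsGT {P : ℕ → ℝ → Prop} (hP : ∀ k, ∀ᶠ ε in 𝓝[>] (0 : ℝ), P k ε) :
    ∃ κ : ℝ → ℕ, Tendsto κ (𝓝[>] (0 : ℝ)) atTop ∧ ∀ᶠ ε in 𝓝[>] (0 : ℝ), P (κ ε) ε := by
  classical
  have hfloor : Tendsto (fun ε : ℝ => ⌊ε⁻¹⌋₊) (𝓝[>] (0 : ℝ)) atTop :=
    tendsto_nat_floor_atTop.comp tendsto_inv_nhdsGT_zero
  refine ⟨fun ε => Nat.findGreatest (fun k => P k ε) ⌊ε⁻¹⌋₊, tendsto_atTop.2 fun N => ?_, ?_⟩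
  · filter_upwards [hP N, hfloor.eventually_ge_atTop N] with ε h1 h2
    exact Nat.le_findGreatest h2 h1
  · filter_upwards [hP 0] with ε h
    exact Nat.findGreatest_spec (P := fun k => P k ε) (Nat.zero_le _) h

/-- Γ-limsup inequality: for every `f ∈ L^1_loc(ℝ^n)` there is a family `(f_ε)` converging to
`f` in `L^1_loc` with `limsup_{ε→0} K_ε(f_ε) ≤ (1/4)·|Df|(ℝ^n)`. -/
theorem stmt1 (n : ℕ) (hn : 1 ≤ n) (f : EuclideanSpace ℝ (Fin n) → ℝ)
    (hf : LocallyIntegrable f volume) :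
    ∃ fε : ℝ → EuclideanSpace ℝ (Fin n) → ℝ,
      (∀ ε : ℝ, 0 < ε → LocallyIntegrable (fε ε) volume) ∧
      (∀ C : Set (EuclideanSpace ℝ (Fin n)), IsCompact C →
        Tendsto (fun ε => ∫ x in C, |fε ε x - f x|) (𝓝[>] (0 : ℝ)) (𝓝 0)) ∧
      limsup (fun ε => K n ε (fε ε)) (𝓝[>] (0 : ℝ)) ≤ totalVariation n f / 4 := by
  by_cases hV : totalVariation n f = ⊤
  · refine ⟨fun _ => f, fun _ _ => hf, fun C _ => by simp, ?_⟩
    rw [hV, ENNReal.top_div_of_ne_top (by simp)]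
    exact le_top
  obtain ⟨κ, hκ, hK⟩ := exists_diagonal_nhdsGT fun k =>
    eventually_K_mollify_le hn hf hV k (δ := (k : ℝ≥0∞)⁻¹) (by simp)
  refine ⟨fun ε => mollify f (κ ε),
    fun ε _ => (contDiff_mollify hf (κ ε)).continuous.locallyIntegrable,
    fun C hC => (tendsto_setIntegral_mollify_sub hf hC).comp hκ, ?_⟩
  have hlim : Tendsto (fun ε => totalVariation n f / 4 + ((κ ε : ℕ) : ℝ≥0∞)⁻¹) (𝓝[>] (0 : ℝ))
      (𝓝 (totalVariation n f / 4)) := by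
    simpa using tendsto_const_nhds.add (ENNReal.tendsto_inv_nat_nhds_zero.comp hκ)
  exact (limsup_le_limsup hK).trans_eq hlim.limsup_eq
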